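/- Let f : 𝔸^× → ℝ be defined by f(x) = e^{-π x_∞²} if x_p ∈ ℤ_p for all primes p, and f(x) = 0 otherwise. Let s₁, s₂ be complex numbers with Re(s₁) > 1 and Re(s₂) > 1. Then ∫∫_{{(x₁,x₂) : |x₁| > |x₂|}} f(x₁)|x₁|^{s₁} f(x₂)|x₂|^{s₂} dμ(x₁) dμ(x₂) = ∫∫_{{t₁ > t₂ > 0}} (θ(it₁²) - 1)(θ(it₂²) - 1) t₁^{s₁-1} t₂^{s₂-1} dt₁ dt₂, where θ(τ) = ∑_{n ∈ ℤ} e^{π i n² τ} is the Jacobi theta function. -/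

import Mathlib

open MeasureTheory
open scoped Classical

noncomputable section

instance (p : Nat.Primes) : Fact (p : ℕ).Prime := ⟨p.2⟩

/-- The group in which finite ideles live: tuples of nonzero `p`-adic numbers. -/
abbrev IdeleComponents : Type := ∀ p : Nat.Primes, ℚ_[(p : ℕ)]ˣ

/-- The group of finite ideles of `ℚ`: tuples of nonzero `p`-adic numbers which are
`p`-adic units for all but finitely many `p` (the unit group of the restricted
product of the `ℚ_p` with respect to the `ℤ_p`). -/
def FiniteIdeles : Subgroup IdeleComponents where
  carrier := {x | {p : Nat.Primes | ‖((x p : ℚ_[(p : ℕ)]))‖ ≠ 1}.Finite}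
  one_mem' := by
    simp
  mul_mem' := by
    intro x y hx hy
    refine (hx.union hy).subset ?_
    intro p hp
    by_contra h
    simp only [Set.mem_union, Set.mem_setOf_eq, not_or, not_not] at h
    apply hp
    simp [Pi.mul_apply, Units.val_mul, norm_mul, h.1, h.2]
  inv_mem' := by
    intro x hx
    refine hx.subset ?_
    intro p hp
    simp only [Set.mem_setOf_eq, Pi.inv_apply] at hp ⊢
    rw [Units.val_inv_eq_inv_val, norm_inv] at hp
    intro h
    rw [h] at hp
    simp at hp

/-- The idele norm of a finite idele: the product `∏_p |x_p|_p` over all primes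
(all but finitely many factors equal `1`). -/
def fnorm (x : FiniteIdeles) : ℝ :=
  ∏ᶠ p : Nat.Primes, ‖((x : IdeleComponents) p : ℚ_[(p : ℕ)])‖

/-- A finite idele is integral if all of its components are `p`-adic integers. -/
def IsIntegralIdele (x : FiniteIdeles) : Prop :=
  ∀ p : Nat.Primes, ‖((x : IdeleComponents) p : ℚ_[(p : ℕ)])‖ ≤ 1

/-- The subset `Ẑ^×` of the finite ideles: all components are `p`-adic units. -/
def zHatUnits : Set FiniteIdeles :=
  {x | ∀ p : Nat.Primes, ‖((x : IdeleComponents) p : ℚ_[(p : ℕ)])‖ = 1}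


/-- The idele group of `ℚ`, presented as `ℝˣ × 𝔸_f^×`. -/
abbrev Ideles : Type := ℝˣ × FiniteIdeles

/-- The idele norm `|x| = |x_∞|_∞ · ∏_p |x_p|_p`. -/
def inorm (x : Ideles) : ℝ := |(x.1 : ℝ)| * fnorm x.2

open Set

lemma padic_norm_natCast (p : Nat.Primes) {n : ℕ} (hn : n ≠ 0) :
    ‖(n : ℚ_[(p : ℕ)])‖ = ((p : ℝ) ^ n.factorization p)⁻¹ := by
  rw [Padic.norm_eq_zpow_neg_valuation (Nat.cast_ne_zero.mpr hn), Padic.valuation_natCast,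
    zpow_neg, zpow_natCast, Nat.factorization_def _ p.2]

/-- A positive integer, diagonally embedded into the finite ideles. -/
def natFiniteIdele (n : ℕ+) : FiniteIdeles where
  val p := Units.mk0 ((n : ℕ) : ℚ_[(p : ℕ)]) (Nat.cast_ne_zero.mpr n.ne_zero)
  property := by
    refine ((n : ℕ).primeFactors.finite_toSet.preimage
      Nat.Primes.coe_nat_injective.injOn).subset fun (p : Nat.Primes) hp => ?_
    have hdvd : (p : ℕ) ∣ n := by
      by_contra h
      exact hp ((Padic.norm_natCast_eq_one_iff (p := (p : ℕ))).mpr (p.2.coprime_iff_not_dvd.mpr h))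
    exact Nat.mem_primeFactors.mpr ⟨p.2, hdvd, n.ne_zero⟩

lemma norm_natFiniteIdele (n : ℕ+) (p : Nat.Primes) :
    ‖((natFiniteIdele n : IdeleComponents) p : ℚ_[(p : ℕ)])‖
      = ((p : ℝ) ^ (n : ℕ).factorization p)⁻¹ :=
  padic_norm_natCast p n.ne_zero

lemma fnorm_mul (x y : FiniteIdeles) : fnorm (x * y) = fnorm x * fnorm y := by
  unfold fnorm
  rw [← finprod_mul_distrib x.2 y.2]
  simp

lemma fnorm_natFiniteIdele (n : ℕ+) : fnorm (natFiniteIdele n) = ((n : ℕ) : ℝ)⁻¹ := by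
  let s : Finset Nat.Primes :=
    (n : ℕ).primeFactors.preimage _ Nat.Primes.coe_nat_injective.injOn
  have hsub : (Function.mulSupport fun p : Nat.Primes =>
      ((p : ℝ) ^ (n : ℕ).factorization p)⁻¹) ⊆ (s : Set Nat.Primes) := by
    intro p hp
    rw [Function.mem_mulSupport] at hp
    refine Finset.mem_coe.mpr (Finset.mem_preimage.mpr ?_)
    rw [← Nat.support_factorization, Finsupp.mem_support_iff]
    intro h
    simp [h] at hp
  simp only [fnorm, norm_natFiniteIdele]
  rw [finprod_eq_prod_of_mulSupport_subset _ hsub]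
  refine (Finset.prod_preimage _ _ Nat.Primes.coe_nat_injective.injOn
    (fun p : ℕ => ((p : ℝ) ^ (n : ℕ).factorization p)⁻¹) fun p hp h =>
      absurd ⟨⟨p, Nat.prime_of_mem_primeFactors hp⟩, rfl⟩ h).trans ?_
  rw [Finset.prod_inv_distrib]
  congr 1
  conv_rhs => rw [← Nat.prod_factorization_pow_eq_self n.ne_zero]
  simp [Finsupp.prod]

lemma fnorm_eq_one_of_mem_zHatUnits {x : FiniteIdeles} (hx : x ∈ zHatUnits) : fnorm x = 1 := by
  simp only [fnorm, finprod_eq_one_of_forall_eq_one hx]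

lemma IsIntegralIdele.exists_natFiniteIdele {x : FiniteIdeles} (hx : IsIntegralIdele x) :
    ∃ n : ℕ+, (natFiniteIdele n)⁻¹ * x ∈ zHatUnits := by
  have hv (p : Nat.Primes) : ∃ k : ℕ,
      ‖((x : IdeleComponents) p : ℚ_[(p : ℕ)])‖ = ((p : ℝ) ^ k)⁻¹ := by
    have h := hx p
    have hp : (1 : ℝ) < p := by exact_mod_cast p.2.one_lt
    rw [Padic.norm_eq_zpow_neg_valuation (Units.ne_zero _)] at h ⊢
    rw [zpow_le_one_iff_right₀ hp, neg_nonpos] at h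
    lift Padic.valuation ((x : IdeleComponents) p : ℚ_[(p : ℕ)]) to ℕ using h with k
    exact ⟨k, by rw [zpow_neg, zpow_natCast]⟩
  choose k hk using hv
  let S : Finset ℕ := (x.2.image Subtype.val : Set.Finite _).toFinset
  let e : ℕ → ℕ := fun p => if hp : p.Prime then k ⟨p, hp⟩ else 0
  have he (p : Nat.Primes) : e p = k p := dif_pos p.2
  have hS : ∀ p, e p ≠ 0 → p ∈ S := by
    intro p hp
    by_cases h : p.Prime
    · simp only [S, Set.Finite.mem_toFinset]
      obtain ⟨q, rfl⟩ : ∃ q : Nat.Primes, (q : ℕ) = p := ⟨⟨p, h⟩, rfl⟩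
      refine mem_image_of_mem _ ?_
      have h1 : k q ≠ 0 := by
        rw [← he]
        exact hp
      change ‖((x : IdeleComponents) q : ℚ_[(q : ℕ)])‖ ≠ 1
      rw [hk, ne_eq, inv_eq_one]
      exact (one_lt_pow₀ (by exact_mod_cast h.one_lt) h1).ne'
    · simp [e, h] at hp
  let F : ℕ →₀ ℕ := Finsupp.onFinset S e hS
  have hF : ∀ p ∈ F.support, p.Prime := by
    intro p hp
    by_contra h
    simp [F, e, h] at hp
  have hn : F.prod (· ^ ·) ≠ 0 :=
    Finset.prod_ne_zero_iff.mpr fun p hp => pow_ne_zero _ (hF p hp).ne_zero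
  refine ⟨⟨F.prod (· ^ ·), Nat.pos_of_ne_zero hn⟩, fun p => ?_⟩
  have h1 := norm_natFiniteIdele ⟨F.prod (· ^ ·), Nat.pos_of_ne_zero hn⟩ p
  rw [PNat.mk_coe, Nat.prod_pow_factorization_eq_self hF] at h1
  have h2 : F p = k p := he p
  have h0 : ((p : ℝ) ^ k p)⁻¹ ≠ 0 :=
    inv_ne_zero (pow_ne_zero _ (Nat.cast_ne_zero.mpr p.2.ne_zero))
  simp only [Subgroup.coe_mul, Subgroup.coe_inv, Pi.mul_apply, Pi.inv_apply, Units.val_mul,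
    Units.val_inv_eq_inv_val, norm_mul, norm_inv, h1, h2, hk]
  exact inv_mul_cancel₀ h0

lemma isIntegralIdele_of_mem {x : FiniteIdeles} {n : ℕ+}
    (hx : (natFiniteIdele n)⁻¹ * x ∈ zHatUnits) : IsIntegralIdele x := by
  intro p
  have h : ((natFiniteIdele n : IdeleComponents) p : ℚ_[(p : ℕ)])
      * (((natFiniteIdele n)⁻¹ * x : FiniteIdeles) : IdeleComponents) p
      = (x : IdeleComponents) p := by simp
  rw [← h, norm_mul, hx p, mul_one]
  rw [norm_natFiniteIdele]
  exact inv_le_one_of_one_le₀ (one_le_pow₀ (by exact_mod_cast p.2.one_le))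

lemma setOf_isIntegralIdele :
    {x : FiniteIdeles | IsIntegralIdele x}
      = ⋃ n : ℕ+, (fun x => (natFiniteIdele n)⁻¹ * x) ⁻¹' zHatUnits := by
  ext x
  simp only [mem_ofPred_eq, mem_iUnion, mem_preimage]
  exact ⟨fun h => h.exists_natFiniteIdele, fun ⟨_, h⟩ => isIntegralIdele_of_mem h⟩

lemma pairwise_disjoint_natFiniteIdele_zHatUnits :
    Pairwise (Function.onFun Disjoint
      fun n : ℕ+ => (fun x => (natFiniteIdele n)⁻¹ * x) ⁻¹' zHatUnits) := by
  have key {n : ℕ+} {x : FiniteIdeles} (hx : (natFiniteIdele n)⁻¹ * x ∈ zHatUnits) :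
      fnorm x = ((n : ℕ) : ℝ)⁻¹ := by
    rw [← mul_inv_cancel_left (natFiniteIdele n) x, fnorm_mul, fnorm_natFiniteIdele,
      fnorm_eq_one_of_mem_zHatUnits hx, mul_one]
  intro m n hmn
  refine Set.disjoint_left.mpr fun x hm hn => hmn ?_
  have h := (key hm).symm.trans (key hn)
  exact PNat.coe_injective (Nat.cast_injective (inv_injective h))

open scoped ENNReal

lemma lintegral_comp_exp (H : ℝ → ℝ≥0∞) :
    ∫⁻ u : ℝ, H (Real.exp u) = ∫⁻ t in Ioi (0 : ℝ), ENNReal.ofReal t⁻¹ * H t := by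
  have h := lintegral_image_eq_lintegral_abs_deriv_mul MeasurableSet.univ
    (fun x _ => (Real.hasDerivAt_exp x).hasDerivWithinAt) Real.exp_injective.injOn
    (fun t => ENNReal.ofReal t⁻¹ * H t)
  rw [image_univ, Real.range_exp, Measure.restrict_univ] at h
  rw [h]
  refine lintegral_congr fun u => ?_
  rw [← mul_assoc, ← ENNReal.ofReal_mul (abs_nonneg _), abs_of_pos (Real.exp_pos u),
    mul_inv_cancel₀ (Real.exp_ne_zero u), ENNReal.ofReal_one, one_mul]

lemma eq_smul_volume_of_isAddLeftInvariant (ρ : Measure ℝ) [ρ.IsAddLeftInvariant]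
    (h0 : ρ (Icc 0 1) ≠ 0) (htop : ρ (Icc 0 1) ≠ ∞) : ρ = ρ (Icc 0 1) • volume := by
  have : ρ.IsAddHaarMeasure :=
    Measure.isAddHaarMeasure_of_isCompact_nonempty_interior ρ (Icc 0 1) isCompact_Icc
      (by simp) h0 htop
  have h := Measure.addHaarMeasure_unique ρ TopologicalSpace.PositiveCompacts.Icc01
  rwa [addHaarMeasure_eq_volume] at h

lemma measurable_units_val [MeasurableSpace ℝˣ] [BorelSpace ℝˣ] :
    Measurable ((↑) : ℝˣ → ℝ) :=
  Units.continuous_val.measurable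

lemma measurable_inorm [MeasurableSpace ℝˣ] [BorelSpace ℝˣ] [MeasurableSpace FiniteIdeles]
    (hnorm : Measurable fnorm) : Measurable inorm :=
  (continuous_abs.measurable.comp (measurable_units_val.comp measurable_fst)).mul
    (hnorm.comp measurable_snd)

lemma measurable_mul_left_finiteIdeles [MeasurableSpace ℝˣ] [MeasurableSpace FiniteIdeles]
    {μ : Measure Ideles} (hinv : ∀ a : Ideles, MeasurePreserving (fun x => a * x) μ μ)
    (a : FiniteIdeles) : Measurable fun x : FiniteIdeles => a * x := by
  have h : Measurable fun x : FiniteIdeles => (((1, a) : Ideles) * (1, x)).2 :=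
    measurable_snd.comp ((hinv (1, a)).measurable.comp measurable_prodMk_left)
  exact h

/-- On `ℝˣ × Ẑˣ`, the pushforward of the normalized Haar measure along `log |x_∞|` is
twice Lebesgue measure. -/
lemma map_log_restrict_zHatUnits [MeasurableSpace ℝˣ] [BorelSpace ℝˣ]
    [MeasurableSpace FiniteIdeles] {μ : Measure Ideles}
    (hinv : ∀ a : Ideles, MeasurePreserving (fun x => a * x) μ μ)
    (hZmeas : MeasurableSet zHatUnits)
    (hB : μ {x : Ideles | 1 ≤ (x.1 : ℝ) ∧ (x.1 : ℝ) ≤ Real.exp 1 ∧ x.2 ∈ zHatUnits} = 1) :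
    (μ.restrict (Prod.snd ⁻¹' zHatUnits)).map (fun x : Ideles => Real.log (x.1 : ℝ))
      = (2 : ℝ≥0∞) • volume := by
  have hS : MeasurableSet (Prod.snd ⁻¹' zHatUnits : Set Ideles) := measurable_snd hZmeas
  have hv : Measurable fun x : Ideles => (x.1 : ℝ) := measurable_units_val.comp measurable_fst
  have hL : Measurable fun x : Ideles => Real.log (x.1 : ℝ) := Real.measurable_log.comp hv
  set ρ := (μ.restrict (Prod.snd ⁻¹' zHatUnits)).map (fun x : Ideles => Real.log (x.1 : ℝ))
    with hρ
  have : ρ.IsAddLeftInvariant := by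
    refine ⟨fun c => ?_⟩
    let a : Ideles := (Units.mk0 (Real.exp c) (Real.exp_ne_zero c), 1)
    have ha : (fun x => a * x) ⁻¹' (Prod.snd ⁻¹' zHatUnits) = Prod.snd ⁻¹' zHatUnits := by
      ext x
      simp [a]
    have hpres := (hinv a).restrict_preimage hS
    rw [ha] at hpres
    have hlog : (fun x => c + x) ∘ (fun x : Ideles => Real.log (x.1 : ℝ))
        = (fun x : Ideles => Real.log (x.1 : ℝ)) ∘ fun x => a * x := by
      ext x
      simp [a, Real.log_mul]
    rw [hρ, Measure.map_map (measurable_const_add c) hL, hlog,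
      ← Measure.map_map hL hpres.measurable, hpres.map_eq]
  let B : Set Ideles :=
    {x | 1 ≤ (x.1 : ℝ) ∧ (x.1 : ℝ) ≤ Real.exp 1 ∧ x.2 ∈ zHatUnits}
  have hBm : MeasurableSet B :=
    (measurableSet_le measurable_const hv).inter
      ((measurableSet_le hv measurable_const).inter hS)
  have hinvB := hinv ((-1 : ℝˣ), 1)
  have hunion : (fun x : Ideles => Real.log (x.1 : ℝ)) ⁻¹' Icc 0 1 ∩ Prod.snd ⁻¹' zHatUnits
      = B ∪ (fun x : Ideles => ((-1 : ℝˣ), (1 : FiniteIdeles)) * x) ⁻¹' B := by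
    ext x
    have hx : (x.1 : ℝ) ≠ 0 := x.1.ne_zero
    simp only [B, mem_inter_iff, mem_preimage, mem_Icc, mem_union, mem_ofPred_eq, Prod.fst_mul,
      Prod.snd_mul, Units.val_neg, one_mul, neg_mul]
    rcases lt_or_gt_of_ne hx with h | h
    · rw [← Real.log_neg_eq_log, Real.log_nonneg_iff (neg_pos.mpr h),
        Real.log_le_iff_le_exp (neg_pos.mpr h)]
      have : ¬ 1 ≤ (x.1 : ℝ) := by linarith
      tauto
    · rw [Real.log_nonneg_iff h, Real.log_le_iff_le_exp h]
      have : ¬ 1 ≤ -(x.1 : ℝ) := by linarith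
      tauto
  have hdisj : Disjoint B ((fun x : Ideles => ((-1 : ℝˣ), (1 : FiniteIdeles)) * x) ⁻¹' B) := by
    refine Set.disjoint_left.mpr fun x hx hx' => ?_
    have h1 : 1 ≤ (x.1 : ℝ) := hx.1
    have h2 : 1 ≤ (((-1 : ℝˣ) * x.1 : ℝˣ) : ℝ) := hx'.1
    simp only [Units.val_neg, neg_mul, one_mul] at h2
    linarith
  have hmass : ρ (Icc 0 1) = 2 := by
    rw [hρ, Measure.map_apply hL measurableSet_Icc,
      Measure.restrict_apply (hL measurableSet_Icc), hunion,
      measure_union hdisj (hinvB.measurable hBm), hinvB.measure_preimage hBm.nullMeasurableSet,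
      show μ B = 1 from hB, one_add_one_eq_two]
  rw [eq_smul_volume_of_isAddLeftInvariant ρ (by simp [hmass]) (by simp [hmass]), hmass]

lemma setLIntegral_zHatUnits_comp_abs [MeasurableSpace ℝˣ] [BorelSpace ℝˣ]
    [MeasurableSpace FiniteIdeles] {μ : Measure Ideles}
    (hinv : ∀ a : Ideles, MeasurePreserving (fun x => a * x) μ μ)
    (hZmeas : MeasurableSet zHatUnits)
    (hB : μ {x : Ideles | 1 ≤ (x.1 : ℝ) ∧ (x.1 : ℝ) ≤ Real.exp 1 ∧ x.2 ∈ zHatUnits} = 1)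
    {H : ℝ → ℝ≥0∞} (hH : Measurable H) :
    ∫⁻ x in Prod.snd ⁻¹' zHatUnits, H |(x.1 : ℝ)| ∂μ
      = 2 * ∫⁻ t in Ioi (0 : ℝ), ENNReal.ofReal t⁻¹ * H t := by
  have hL : Measurable fun x : Ideles => Real.log (x.1 : ℝ) :=
    Real.measurable_log.comp (measurable_units_val.comp measurable_fst)
  have habs (x : Ideles) : H |(x.1 : ℝ)| = H (Real.exp (Real.log (x.1 : ℝ))) := by
    rw [Real.exp_log_eq_abs x.1.ne_zero]
  simp_rw [habs]
  rw [← lintegral_map (f := fun u => H (Real.exp u)) (hH.comp Real.measurable_exp) hL,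
    map_log_restrict_zHatUnits hinv hZmeas hB, lintegral_smul_measure, lintegral_comp_exp,
    smul_eq_mul]

/-- The function `t ↦ ∑_{n ≥ 1} 2 e^{-π n² t²}`, valued in `[0, ∞]`. -/
def thetaTail (t : ℝ) : ℝ≥0∞ :=
  2 * ∑' n : ℕ+, ENNReal.ofReal (Real.exp (-(Real.pi * ((n : ℕ) * t) ^ 2)))

lemma measurable_thetaTail : Measurable thetaTail := by
  unfold thetaTail
  fun_prop

lemma hasSum_exp_jacobiTheta {t : ℝ} (ht : 0 < t) :
    HasSum (fun n : ℕ+ => ((Real.exp (-(Real.pi * ((n : ℕ) * t) ^ 2)) : ℝ) : ℂ))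
      ((jacobiTheta (Complex.I * (t : ℂ) ^ 2) - 1) / 2) := by
  have him : 0 < (Complex.I * (t : ℂ) ^ 2).im := by
    rw [← Complex.ofReal_pow, Complex.I_mul_im, Complex.ofReal_re]
    positivity
  rw [hasSum_pnat_iff_hasSum_succ
    (f := fun n : ℕ => ((Real.exp (-(Real.pi * (n * t) ^ 2)) : ℝ) : ℂ))]
  convert hasSum_nat_jacobiTheta him using 2 with n
  rw [Complex.ofReal_exp]
  congr 1
  push_cast
  linear_combination (-(Real.pi : ℂ) * ((n + 1) * t) ^ 2) * Complex.I_sq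

lemma thetaTail_eq_ofReal {t : ℝ} (ht : 0 < t) :
    thetaTail t
      = ENNReal.ofReal (2 * ∑' n : ℕ+, Real.exp (-(Real.pi * ((n : ℕ) * t) ^ 2))) := by
  rw [ENNReal.ofReal_mul zero_le_two, ENNReal.ofReal_tsum_of_nonneg
    (fun n => (Real.exp_pos _).le)
    (Complex.summable_ofReal.mp (hasSum_exp_jacobiTheta ht).summable)]
  simp [thetaTail]

lemma toReal_thetaTail {t : ℝ} (ht : 0 < t) :
    ((thetaTail t).toReal : ℂ) = jacobiTheta (Complex.I * (t : ℂ) ^ 2) - 1 := by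
  rw [thetaTail_eq_ofReal ht, ENNReal.toReal_ofReal
    (mul_nonneg zero_le_two (tsum_nonneg fun n => (Real.exp_pos _).le)), Complex.ofReal_mul,
    Complex.ofReal_tsum, (hasSum_exp_jacobiTheta ht).tsum_eq]
  push_cast
  ring

lemma integral_prod_map_withDensity {X : Type*} [MeasurableSpace X] (ν : Measure X) [SFinite ν]
    {w : X → ℝ≥0∞} (hw : Measurable w) (hw_top : ∀ᵐ x ∂ν, w x < ∞) {φ : X → ℝ}
    (hφ : Measurable φ) {g : ℝ × ℝ → ℂ} (hg : Measurable g) :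
    ∫ q, g q ∂(((ν.withDensity w).map φ).prod ((ν.withDensity w).map φ))
      = ∫ z, ((w z.1).toReal * (w z.2).toReal) • g (φ z.1, φ z.2) ∂(ν.prod ν) := by
  rw [Measure.map_prod_map _ _ hφ hφ,
    integral_map (hφ.prodMap hφ).aemeasurable hg.aestronglyMeasurable,
    prod_withDensity hw hw, integral_withDensity_eq_integral_toReal_smul]
  · simp [Prod.map]
  · fun_prop
  · filter_upwards [Measure.quasiMeasurePreserving_fst.ae hw_top,
      Measure.quasiMeasurePreserving_snd.ae hw_top] with z h1 h2
    exact ENNReal.mul_lt_top h1 h2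

/-- The integral over `ℝˣ × n Ẑˣ` reduces, by translation by the principal idele `n` (which has
idele norm `1`), to an integral over `t > 0`. -/
lemma setLIntegral_natFiniteIdele_zHatUnits [MeasurableSpace ℝˣ] [BorelSpace ℝˣ]
    [MeasurableSpace FiniteIdeles] {μ : Measure Ideles}
    (hinv : ∀ a : Ideles, MeasurePreserving (fun x => a * x) μ μ)
    (hnorm : Measurable fnorm) (hZmeas : MeasurableSet zHatUnits)
    (hB : μ {x : Ideles | 1 ≤ (x.1 : ℝ) ∧ (x.1 : ℝ) ≤ Real.exp 1 ∧ x.2 ∈ zHatUnits} = 1)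
    {g : ℝ → ℝ≥0∞} (hg : Measurable g) (n : ℕ+) :
    ∫⁻ x in Prod.snd ⁻¹' ((fun y => (natFiniteIdele n)⁻¹ * y) ⁻¹' zHatUnits),
        ENNReal.ofReal (Real.exp (-(Real.pi * (x.1 : ℝ) ^ 2))) * g (inorm x) ∂μ
      = 2 * ∫⁻ t in Ioi (0 : ℝ), ENNReal.ofReal t⁻¹ *
          (ENNReal.ofReal (Real.exp (-(Real.pi * ((n : ℕ) * t) ^ 2))) * g t) := by
  have hn : ((n : ℕ) : ℝ) ≠ 0 := Nat.cast_ne_zero.mpr n.ne_zero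
  let a : Ideles := (Units.mk0 ((n : ℕ) : ℝ) hn, natFiniteIdele n)
  have hv : Measurable fun x : Ideles => (x.1 : ℝ) := measurable_units_val.comp measurable_fst
  have hT : MeasurableSet (Prod.snd ⁻¹'
      ((fun y => (natFiniteIdele n)⁻¹ * y) ⁻¹' zHatUnits) : Set Ideles) :=
    measurable_snd (measurable_mul_left_finiteIdeles hinv _ hZmeas)
  have ha : (fun x => a * x) ⁻¹'
      (Prod.snd ⁻¹' ((fun y => (natFiniteIdele n)⁻¹ * y) ⁻¹' zHatUnits))
      = Prod.snd ⁻¹' zHatUnits := by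
    ext x
    simp [a]
  have hgm : Measurable fun x : Ideles =>
      ENNReal.ofReal (Real.exp (-(Real.pi * (x.1 : ℝ) ^ 2))) * g (inorm x) := by
    have := measurable_inorm hnorm
    fun_prop
  rw [← (hinv a).setLIntegral_comp_preimage hT hgm, ha,
    ← setLIntegral_zHatUnits_comp_abs hinv hZmeas hB (by fun_prop)]
  refine setLIntegral_congr_fun (measurable_snd hZmeas) fun x hx => ?_
  have hx1 : fnorm x.2 = 1 := fnorm_eq_one_of_mem_zHatUnits hx
  simp only [inorm, a, Prod.fst_mul, Prod.snd_mul, Units.val_mul, Units.val_mk0, abs_mul,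
    fnorm_mul, fnorm_natFiniteIdele, hx1, Nat.abs_cast, mul_pow, sq_abs]
  congr 2
  field_simp

lemma measurable_ite_isIntegralIdele_gaussian [MeasurableSpace ℝˣ] [BorelSpace ℝˣ]
    [MeasurableSpace FiniteIdeles] {μ : Measure Ideles}
    (hinv : ∀ a : Ideles, MeasurePreserving (fun x => a * x) μ μ)
    (hZmeas : MeasurableSet zHatUnits) :
    Measurable fun x : Ideles => if IsIntegralIdele x.2 then
      Real.exp (-(Real.pi * (x.1 : ℝ) ^ 2)) else 0 := by
  have hv : Measurable fun x : Ideles => (x.1 : ℝ) := measurable_units_val.comp measurable_fst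
  have hint : MeasurableSet {x : FiniteIdeles | IsIntegralIdele x} := by
    rw [setOf_isIntegralIdele]
    exact MeasurableSet.iUnion fun n => measurable_mul_left_finiteIdeles hinv _ hZmeas
  exact Measurable.ite (measurable_snd hint) (by fun_prop) measurable_const

/-- The pushforward of `f μ` along the idele norm is `(θ(it²) - 1) dt / t` on `t > 0`. -/
lemma map_inorm_withDensity [MeasurableSpace ℝˣ] [BorelSpace ℝˣ]
    [MeasurableSpace FiniteIdeles] {μ : Measure Ideles}
    (hinv : ∀ a : Ideles, MeasurePreserving (fun x => a * x) μ μ)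
    (hnorm : Measurable fnorm) (hZmeas : MeasurableSet zHatUnits)
    (hB : μ {x : Ideles | 1 ≤ (x.1 : ℝ) ∧ (x.1 : ℝ) ≤ Real.exp 1 ∧ x.2 ∈ zHatUnits} = 1)
    (f : Ideles → ℝ)
    (hf : ∀ x : Ideles, f x =
      if IsIntegralIdele x.2 then Real.exp (-(Real.pi * (x.1 : ℝ) ^ 2)) else 0) :
    (μ.withDensity fun x => ENNReal.ofReal (f x)).map inorm
      = (volume.restrict (Ioi 0)).withDensity
          fun t => ENNReal.ofReal t⁻¹ * thetaTail t := by
  have hfm : Measurable f := by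
    rw [funext hf]
    exact measurable_ite_isIntegralIdele_gaussian hinv hZmeas
  have hN := measurable_inorm hnorm
  have hθ := measurable_thetaTail
  have hT (n : ℕ+) : MeasurableSet (Prod.snd ⁻¹'
      ((fun y => (natFiniteIdele n)⁻¹ * y) ⁻¹' zHatUnits) : Set Ideles) :=
    measurable_snd (measurable_mul_left_finiteIdeles hinv _ hZmeas)
  refine Measure.ext_of_lintegral _ fun g hg => ?_
  rw [lintegral_map hg hN,
    lintegral_withDensity_eq_lintegral_mul _ hfm.ennreal_ofReal (g := fun x => g (inorm x))
      (hg.comp hN),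
    lintegral_withDensity_eq_lintegral_mul _ (by fun_prop) hg]
  have hfU : (fun x => ENNReal.ofReal (f x) * g (inorm x))
      = (⋃ n : ℕ+, Prod.snd ⁻¹' ((fun y => (natFiniteIdele n)⁻¹ * y) ⁻¹' zHatUnits)).indicator
        fun x : Ideles =>
          ENNReal.ofReal (Real.exp (-(Real.pi * (x.1 : ℝ) ^ 2))) * g (inorm x) := by
    ext x
    rw [← preimage_iUnion, ← setOf_isIntegralIdele, hf]
    by_cases hx : IsIntegralIdele x.2
    · rw [indicator_of_mem hx, if_pos hx]
    · rw [indicator_of_notMem hx, if_neg hx, ENNReal.ofReal_zero, zero_mul]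
  calc ∫⁻ x, ENNReal.ofReal (f x) * g (inorm x) ∂μ
      = ∑' n : ℕ+, 2 * ∫⁻ t in Ioi (0 : ℝ), ENNReal.ofReal t⁻¹ *
          (ENNReal.ofReal (Real.exp (-(Real.pi * ((n : ℕ) * t) ^ 2))) * g t) := by
        rw [hfU, lintegral_indicator (MeasurableSet.iUnion hT), lintegral_iUnion hT
          fun m n hmn => (pairwise_disjoint_natFiniteIdele_zHatUnits hmn).preimage _]
        exact tsum_congr fun n =>
          setLIntegral_natFiniteIdele_zHatUnits hinv hnorm hZmeas hB hg n
    _ = ∫⁻ t in Ioi (0 : ℝ), ENNReal.ofReal t⁻¹ * thetaTail t * g t := by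
        rw [ENNReal.tsum_mul_left, ← lintegral_tsum fun n => by fun_prop,
          ← lintegral_const_mul _ (by fun_prop)]
        refine lintegral_congr fun t => ?_
        rw [ENNReal.tsum_mul_left, ENNReal.tsum_mul_right, thetaTail]
        ring

/-- Let `μ` be a translation-invariant (Haar) measure on the idele
group `𝔸^× = ℝˣ × 𝔸_f^×` normalized by `μ({x | 1 ≤ x_∞ ≤ e, x_p ∈ ℤ_p^× ∀p}) = 1`
(with `Ẑ^×` and the finite idele norm measurable, as for a Borel measure).  Let
`f(x) = e^{-π x_∞²}` if all `x_p ∈ ℤ_p` and `f(x) = 0` otherwise.  For `Re s₁ > 1`,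
`Re s₂ > 1`, the iterated adelic integral of `f(x₁)|x₁|^{s₁} f(x₂)|x₂|^{s₂}` over
`|x₁| > |x₂|` equals
`∫∫_{t₁>t₂>0} (θ(it₁²)-1)(θ(it₂²)-1) t₁^{s₁-1} t₂^{s₂-1} dt₁ dt₂`,
with `θ` the Jacobi theta function. -/
theorem adelic_iterated_completed_zeta
    [MeasurableSpace ℝˣ] [BorelSpace ℝˣ] [MeasurableSpace FiniteIdeles]
    (μ : Measure Ideles) [SFinite μ]
    (hinv : ∀ a : Ideles, MeasurePreserving (fun x => a * x) μ μ)
    (hnorm : Measurable fnorm) (hZmeas : MeasurableSet zHatUnits)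
    (hB : μ {x : Ideles | 1 ≤ (x.1 : ℝ) ∧ (x.1 : ℝ) ≤ Real.exp 1 ∧ x.2 ∈ zHatUnits} = 1)
    (f : Ideles → ℝ)
    (hf : ∀ x : Ideles, f x =
      if IsIntegralIdele x.2 then Real.exp (-(Real.pi * (x.1 : ℝ) ^ 2)) else 0)
    (s₁ s₂ : ℂ) (h₁ : 1 < s₁.re) (h₂ : 1 < s₂.re) :
    ∫ z in {q : Ideles × Ideles | inorm q.2 < inorm q.1},
      (f z.1 : ℂ) * (inorm z.1 : ℂ) ^ s₁ * (f z.2 : ℂ) * (inorm z.2 : ℂ) ^ s₂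
        ∂(μ.prod μ)
      = ∫ t in {q : ℝ × ℝ | q.2 < q.1 ∧ 0 < q.2},
          (jacobiTheta (Complex.I * (t.1 : ℂ) ^ 2) - 1) *
            (jacobiTheta (Complex.I * (t.2 : ℂ) ^ 2) - 1) *
            (t.1 : ℂ) ^ (s₁ - 1) * (t.2 : ℂ) ^ (s₂ - 1) := by
  have hf0 (x : Ideles) : 0 ≤ f x := by
    rw [hf]
    split_ifs
    exacts [(Real.exp_pos _).le, le_rfl]
  have hN := measurable_inorm hnorm
  have hfm : Measurable f := by
    rw [funext hf]
    exact measurable_ite_isIntegralIdele_gaussian hinv hZmeas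
  have hθ := measurable_thetaTail
  have hA : MeasurableSet {q : ℝ × ℝ | q.2 < q.1} :=
    measurableSet_lt measurable_snd measurable_fst
  have hA' : MeasurableSet {q : Ideles × Ideles | inorm q.2 < inorm q.1} :=
    measurableSet_lt (hN.comp measurable_snd) (hN.comp measurable_fst)
  let g : ℝ × ℝ → ℂ :=
    {q : ℝ × ℝ | q.2 < q.1}.indicator fun q => (q.1 : ℂ) ^ s₁ * (q.2 : ℂ) ^ s₂
  have hg : Measurable g := Measurable.indicator (by fun_prop) hA
  have hlhs := integral_prod_map_withDensity μ hfm.ennreal_ofReal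
    (Filter.Eventually.of_forall fun x => ENNReal.ofReal_lt_top) hN hg
  have hrhs := integral_prod_map_withDensity (volume.restrict (Ioi (0 : ℝ)))
    (w := fun t => ENNReal.ofReal t⁻¹ * thetaTail t) (by fun_prop)
    ((ae_restrict_iff' measurableSet_Ioi).mpr (Filter.Eventually.of_forall fun t ht =>
      ENNReal.mul_lt_top ENNReal.ofReal_lt_top (thetaTail_eq_ofReal ht ▸ ENNReal.ofReal_lt_top)))
    measurable_id hg
  rw [map_inorm_withDensity hinv hnorm hZmeas hB f hf] at hlhs
  rw [Measure.map_id, hlhs, Measure.prod_restrict] at hrhs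
  have hq : {q : ℝ × ℝ | q.2 < q.1 ∧ 0 < q.2} = {q : ℝ × ℝ | q.2 < q.1} ∩ Ioi 0 ×ˢ Ioi 0 := by
    ext q
    simp only [mem_ofPred_eq, mem_inter_iff, mem_prod, mem_Ioi]
    exact ⟨fun h => ⟨h.1, h.2.trans h.1, h.2⟩, fun h => ⟨h.1, h.2.2⟩⟩
  rw [hq, ← Measure.restrict_restrict hA,
    ← integral_indicator hA, ← integral_indicator hA']
  refine Eq.trans (integral_congr_ae (Filter.Eventually.of_forall fun z => ?_))
    (hrhs.trans (setIntegral_congr_fun (measurableSet_Ioi.prod measurableSet_Ioi) fun t ht => ?_))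
  · by_cases hz : inorm z.2 < inorm z.1
    · simp only [g, indicator, mem_ofPred_eq, hz, if_true,
        ENNReal.toReal_ofReal (hf0 _), Complex.real_smul, Complex.ofReal_mul]
      ring
    · simp [g, indicator, hz]
  · have h1 : (0 : ℝ) < t.1 := ht.1
    have h2 : (0 : ℝ) < t.2 := ht.2
    by_cases hz : t.2 < t.1
    · simp only [g, id, indicator, mem_ofPred_eq, hz, if_true, ENNReal.toReal_mul,
        ENNReal.toReal_ofReal (inv_pos.mpr h1).le, ENNReal.toReal_ofReal (inv_pos.mpr h2).le,
        Complex.real_smul, Complex.ofReal_mul, toReal_thetaTail h1, toReal_thetaTail h2,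
        Complex.cpow_sub _ _ (Complex.ofReal_ne_zero.mpr h1.ne'),
        Complex.cpow_sub _ _ (Complex.ofReal_ne_zero.mpr h2.ne'), Complex.cpow_one,
        Complex.ofReal_inv]
      ring
    · simp [g, indicator, hz]

end
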